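/- Let n ≥ 2 and let γ be a partial transformation of Fin n. Then the submonoid of PT_n generated by T_n together with γ equals PT_n if and only if γ is strictly partial (its domain is a proper subset of Fin n) and the rank of γ (the cardinality of its image) equals n − 1. -/

import Mathlib

/-- The monoid of partial transformations of `Ω`, encoded as functions
`Ω → Option Ω`; multiplication is left-to-right composition. -/
def PT (Ω : Type) : Type := Ω → Option Ω

instance PT.instOne {Ω : Type} : One (PT Ω) := ⟨fun x => some x⟩

instance PT.instMul {Ω : Type} : Mul (PT Ω) := ⟨fun f g x => (f x).bind g⟩

instance PT.instMonoid {Ω : Type} : Monoid (PT Ω) where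
  mul_assoc f g h := by
    funext x
    show ((f x).bind g).bind h = (f x).bind fun y => (g y).bind h
    cases f x <;> rfl
  one_mul f := rfl
  mul_one f := by
    funext x
    show (f x).bind (fun y => some y) = f x
    cases f x <;> rfl

/-- The empty partial transformation. -/
def PT.empty (Ω : Type) : PT Ω := fun _ => none

/-- A partial transformation of `Fin n × Fin m` preserves the uniform
equivalence `(i,j) E (k,l) ↔ j = l` if images of points in the same class
lie in the same class. -/
def PreservesE (n m : ℕ) (α : PT (Fin n × Fin m)) : Prop :=
  ∀ (i k : Fin n) (j : Fin m) (a c : Fin n) (b d : Fin m),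
    α (i, j) = some (a, b) → α (k, j) = some (c, d) → b = d

namespace PT

variable {Ω : Type}

theorem mul_apply (f g : PT Ω) (x : Ω) : (f * g) x = (f x).bind g := rfl

theorem mul_eq_some_iff {f g : PT Ω} {x y : Ω} :
    (f * g) x = some y ↔ ∃ z, f x = some z ∧ g z = some y :=
  Option.bind_eq_some_iff

/-- The image of a partial transformation. -/
def image (f : PT Ω) : Set Ω := {y | ∃ x, f x = some y}

theorem ncard_image_mul_le_left [Finite Ω] (f g : PT Ω) :
    (f * g).image.ncard ≤ f.image.ncard := by
  rw [← Set.ncard_image_of_injective (f * g).image (Option.some_injective Ω)]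
  refine le_trans (Set.ncard_le_ncard ?_ (Set.toFinite _))
    (Set.ncard_image_le (f := g) (Set.toFinite f.image))
  rintro _ ⟨y, ⟨x, hx⟩, rfl⟩
  obtain ⟨z, hz, hzy⟩ := mul_eq_some_iff.mp hx
  exact ⟨z, ⟨x, hz⟩, hzy⟩

theorem ncard_image_mul_le_right [Finite Ω] (f g : PT Ω) :
    (f * g).image.ncard ≤ g.image.ncard := by
  refine Set.ncard_le_ncard ?_ (Set.toFinite _)
  rintro y ⟨x, hx⟩
  obtain ⟨z, -, hzy⟩ := mul_eq_some_iff.mp hx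
  exact ⟨z, hzy⟩

theorem mul_total {f g : PT Ω} (hf : ∀ x, f x ≠ none) (hg : ∀ x, g x ≠ none) (x : Ω) :
    (f * g) x ≠ none := by
  obtain ⟨y, hy⟩ := Option.ne_none_iff_exists'.mp (hf x)
  rw [mul_apply, hy]
  exact hg y

/-- The full transformations together with the partial transformations of rank less than `k`. -/
def totalOrRankLT (Ω : Type) [Finite Ω] (k : ℕ) : Submonoid (PT Ω) where
  carrier := {f | (∀ x, f x ≠ none) ∨ f.image.ncard < k}
  one_mem' := Or.inl fun x => Option.some_ne_none x
  mul_mem' := by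
    rintro f g (hf | hf) hg
    · rcases hg with hg | hg
      · exact Or.inl (mul_total hf hg)
      · exact Or.inr ((ncard_image_mul_le_right f g).trans_lt hg)
    · exact Or.inr ((ncard_image_mul_le_left f g).trans_lt hf)

/-- Every partial transformation has a section over its image. -/
theorem exists_section [Nonempty Ω] (f : PT Ω) :
    ∃ s : Ω → Ω, ∀ y ∈ f.image, f (s y) = some y := by
  classical
  exact ⟨fun y => if h : y ∈ f.image then h.choose else Classical.arbitrary Ω,
    fun y hy => by simpa only [dif_pos hy] using hy.choose_spec⟩

theorem section_injOn {f : PT Ω} {s : Ω → Ω} (hs : ∀ y ∈ f.image, f (s y) = some y) :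
    Set.InjOn s f.image := by
  intro y hy z hz h
  have := hs y hy
  rw [h, hs z hz] at this
  exact (Option.some_injective _ this).symm

theorem section_image_subset {f : PT Ω} {s : Ω → Ω} (hs : ∀ y ∈ f.image, f (s y) = some y)
    {x₀ : Ω} (h₀ : f x₀ = none) : s '' f.image ⊆ {x₀}ᶜ := by
  rintro _ ⟨y, hy, rfl⟩ h
  have := hs y hy
  rw [Set.mem_singleton_iff.mp h, h₀] at this
  exact Option.some_ne_none y this.symm

theorem ncard_image_le_of_eq_none [Finite Ω] {f : PT Ω} {x₀ : Ω} (h₀ : f x₀ = none) :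
    f.image.ncard ≤ Nat.card Ω - 1 := by
  have : Nonempty Ω := ⟨x₀⟩
  obtain ⟨s, hs⟩ := f.exists_section
  rw [← (section_injOn hs).ncard_image, ← Set.ncard_singleton x₀, ← Set.ncard_compl]
  exact Set.ncard_le_ncard (section_image_subset hs h₀) (Set.toFinite _)

/-- A partial transformation undefined at `x₀` whose rank is one less than the number of points
has a left inverse on the complement of `x₀`. -/
theorem exists_leftInverse [Finite Ω] {f : PT Ω} {x₀ : Ω} (h₀ : f x₀ = none)
    (hf : f.image.ncard = Nat.card Ω - 1) :
    ∃ s : Ω → Ω, ∀ x ≠ x₀, ∃ y, f x = some y ∧ s y = x := by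
  have : Nonempty Ω := ⟨x₀⟩
  obtain ⟨s, hs⟩ := f.exists_section
  have himage : s '' f.image = {x₀}ᶜ :=
    Set.eq_of_subset_of_ncard_le (section_image_subset hs h₀)
      (by rw [(section_injOn hs).ncard_image, hf, Set.ncard_compl,
        Set.ncard_singleton]) (Set.toFinite _)
  refine ⟨s, fun x hx => ?_⟩
  obtain ⟨y, hy, rfl⟩ : x ∈ s '' f.image := himage ▸ hx
  exact ⟨y, hs y hy, rfl⟩

/-- Every strictly partial transformation `α` factors as `β * γ * δ` with `β` and `δ` full, when
`γ` is undefined at `x₀` and invertible elsewhere. -/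
theorem exists_factorization {γ α : PT Ω} {x₀ x₁ : Ω} (h₀ : γ x₀ = none) {s : Ω → Ω}
    (hs : ∀ x ≠ x₀, ∃ y, γ x = some y ∧ s y = x) (h₁ : α x₁ = none) :
    ∃ β δ : PT Ω, (∀ x, β x ≠ none) ∧ (∀ x, δ x ≠ none) ∧ α = β * γ * δ := by
  classical
  refine ⟨fun x => some (if α x = none then x₀ else Equiv.swap x₁ x₀ x),
    fun y => some ((α (Equiv.swap x₁ x₀ (s y))).getD x₀),
    fun _ => Option.some_ne_none _, fun _ => Option.some_ne_none _, ?_⟩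
  funext x
  change α x = (γ (if α x = none then x₀ else Equiv.swap x₁ x₀ x)).bind
    fun y => some ((α (Equiv.swap x₁ x₀ (s y))).getD x₀)
  by_cases hx : α x = none
  · simp [hx, h₀]
  · have hne : Equiv.swap x₁ x₀ x ≠ x₀ := by
      intro h
      rw [Equiv.swap_apply_eq_iff, Equiv.swap_apply_right] at h
      exact hx (h ▸ h₁)
    obtain ⟨y, hy, hsy⟩ := hs _ hne
    obtain ⟨z, hz⟩ := Option.ne_none_iff_exists'.mp hx
    simp [hz, hy, hsy]

end PT

/-- For `γ ∈ PT_n`: the submonoid generated by `T_n` together with `γ` is all of `PT_n`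
iff `γ` is strictly partial and has rank `n - 1`. -/
theorem stmt9 (n : ℕ) (hn : 2 ≤ n) (γ : PT (Fin n)) :
    Submonoid.closure ({α : PT (Fin n) | ∀ x, α x ≠ none} ∪ {γ}) = ⊤ ↔
      (∃ x, γ x = none) ∧ {y : Fin n | ∃ x, γ x = some y}.ncard = n - 1 := by
  change _ ↔ _ ∧ γ.image.ncard = n - 1
  constructor
  · intro htop
    let a : Fin n := ⟨0, by omega⟩
    let ε : PT (Fin n) := fun x => if x = a then none else some x
    have hεa : ε a = none := if_pos rfl
    have hε : ε.image.ncard = n - 1 := by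
      have : ε.image = {a}ᶜ := by
        ext y
        simp only [PT.image, ε, Set.mem_ofPred_eq, Set.mem_compl_iff, Set.mem_singleton_iff]
        constructor
        · rintro ⟨x, hx⟩
          split_ifs at hx with h
          exact Option.some_injective _ hx ▸ h
        · exact fun h => ⟨y, if_neg h⟩
      rw [this, Set.ncard_compl, Set.ncard_singleton, Nat.card_fin]
    have hγ : γ ∉ PT.totalOrRankLT (Fin n) (n - 1) := by
      intro hγ
      have hle : Submonoid.closure ({α : PT (Fin n) | ∀ x, α x ≠ none} ∪ {γ}) ≤
          PT.totalOrRankLT (Fin n) (n - 1) := by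
        rw [Submonoid.closure_le]
        rintro α (hα | rfl)
        · exact Or.inl hα
        · exact hγ
      rw [htop] at hle
      rcases hle (Submonoid.mem_top ε) with h | h
      · exact h a hεa
      · exact h.ne hε
    obtain ⟨hpartial, hrank⟩ := not_or.mp hγ
    push Not at hpartial
    obtain ⟨x₀, h₀⟩ := hpartial
    refine ⟨⟨x₀, h₀⟩, le_antisymm ?_ (not_lt.mp hrank)⟩
    simpa only [Nat.card_fin] using PT.ncard_image_le_of_eq_none h₀
  · rintro ⟨⟨x₀, h₀⟩, hrank⟩
    obtain ⟨s, hs⟩ := PT.exists_leftInverse h₀ (by rw [hrank, Nat.card_fin])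
    rw [Submonoid.eq_top_iff']
    intro α
    by_cases hα : ∀ x, α x ≠ none
    · exact Submonoid.subset_closure (Or.inl hα)
    · push Not at hα
      obtain ⟨x₁, h₁⟩ := hα
      obtain ⟨β, δ, hβ, hδ, rfl⟩ := PT.exists_factorization h₀ hs h₁
      exact mul_mem (mul_mem (Submonoid.subset_closure (Or.inl hβ))
        (Submonoid.subset_closure (Or.inr rfl))) (Submonoid.subset_closure (Or.inl hδ))
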